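/- For every r ≥ 0 and all twisted complexes A, B over R, the relation 'there exists an r-homotopy from f to g' is an equivalence relation on the set of morphisms of twisted complexes A → B; moreover it is compatible with composition: if f ≃_r g : A → B and f' ≃_r g' : B → C, then f'∘f ≃_r g'∘g : A → C. -/

import Mathlib

open Finset

noncomputable section

/-- A `(ℤ,ℤ)`-bigraded `R`-module. -/
structure Bigraded (R : Type) [CommRing R] where
  M : ℤ → ℤ → Type
  [acg : ∀ i j, AddCommGroup (M i j)]
  [mod : ∀ i j, Module R (M i j)]

attribute [instance] Bigraded.acg Bigraded.mod

variable {R : Type} [CommRing R]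

/-- Transport along equalities of bidegrees. -/
def Bigraded.cast (A : Bigraded R) {i i' j j' : ℤ} (hi : i = i') (hj : j = j') :
    A.M i j →ₗ[R] A.M i' j' := by subst hi; subst hj; exact LinearMap.id

/-- Maps of bigraded modules of bidegree `(p,q)`. -/
abbrev GMap (A B : Bigraded R) (p q : ℤ) : Type :=
  ∀ i j : ℤ, A.M i j →ₗ[R] B.M (i + p) (j + q)

/-- Change the recorded bidegree of a graded map along equalities of bidegrees. -/
def grecast {A B : Bigraded R} {p q : ℤ} (p' q' : ℤ) (hp : p = p') (hq : q = q')
    (f : GMap A B p q) : GMap A B p' q' :=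
  fun i j => (B.cast (by rw [hp]) (by rw [hq])).comp (f i j)

/-- Composition of graded maps: apply `f` first, then `g`. -/
def gcomp {A B C : Bigraded R} {p q p' q' : ℤ} (g : GMap B C p' q') (f : GMap A B p q) :
    GMap A C (p + p') (q + q') :=
  fun i j => (C.cast (by ring) (by ring)).comp ((g (i + p) (j + q)).comp (f i j))

/-- The identity as a graded map of bidegree `(0,0)`. -/
def idG (A : Bigraded R) : GMap A A 0 0 := fun i j => A.cast (by ring) (by ring)

/-- An element of `wbimod(A,B)_u^v`, i.e. a family of bigraded maps `f_m : A → B` of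
bidegree `(u-m, v-m)` for `m ≥ 0`. -/
abbrev WMap (A B : Bigraded R) (u v : ℤ) : Type :=
  ∀ m : ℕ, GMap A B (u - (m : ℤ)) (v - (m : ℤ))

/-- The family of maps `(d_m)` makes `A` into a twisted complex:
`∑_{i+j=m} (-1)^i d_i d_j = 0` for all `m ≥ 0`. -/
def IsTwDiff (A : Bigraded R) (d : WMap A A 0 1) : Prop :=
  ∀ m : ℕ, ∑ ij ∈ (antidiagonal m).attach,
      ((-1 : ℤ) ^ ij.1.1) •
        grecast (0 - (m : ℤ)) (2 - (m : ℤ))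
          (by have := mem_antidiagonal.mp ij.2; omega)
          (by have := mem_antidiagonal.mp ij.2; omega)
          (gcomp (d ij.1.1) (d ij.1.2)) = 0

/-- The family `(f_m)` is a morphism of twisted complexes from `(A, dA)` to `(B, dB)`:
`∑_{i+j=m} d_i^B f_j = ∑_{i+j=m} (-1)^i f_i d_j^A` for all `m ≥ 0`. -/
def IsTwMor {A B : Bigraded R} (dA : WMap A A 0 1) (dB : WMap B B 0 1)
    (f : WMap A B 0 0) : Prop :=
  ∀ m : ℕ,
    (∑ ij ∈ (antidiagonal m).attach,
      grecast (0 - (m : ℤ)) (1 - (m : ℤ))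
        (by have := mem_antidiagonal.mp ij.2; omega)
        (by have := mem_antidiagonal.mp ij.2; omega)
        (gcomp (dB ij.1.1) (f ij.1.2)))
    = ∑ ij ∈ (antidiagonal m).attach,
      ((-1 : ℤ) ^ ij.1.1) •
        grecast (0 - (m : ℤ)) (1 - (m : ℤ))
          (by have := mem_antidiagonal.mp ij.2; omega)
          (by have := mem_antidiagonal.mp ij.2; omega)
          (gcomp (f ij.1.1) (dA ij.1.2))

/-- A twisted complex (multicomplex) over `R`. -/
structure TwComplex (R : Type) [CommRing R] extends Bigraded R where
  d : WMap toBigraded toBigraded 0 1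
  isTw : IsTwDiff toBigraded d

/-- A morphism of twisted complexes. -/
structure TwMorphism (A B : TwComplex R) where
  f : WMap A.toBigraded B.toBigraded 0 0
  isMor : IsTwMor A.d B.d f

/-- Composition of families: `(g ∘ f)_m = ∑_{i+j=m} g_i f_j`. -/
def compFam {A B C : Bigraded R} (g : WMap B C 0 0) (f : WMap A B 0 0) : WMap A C 0 0 :=
  fun m => ∑ ij ∈ (antidiagonal m).attach,
    grecast (0 - (m : ℤ)) (0 - (m : ℤ))
      (by have := mem_antidiagonal.mp ij.2; omega)
      (by have := mem_antidiagonal.mp ij.2; omega)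
      (gcomp (g ij.1.1) (f ij.1.2))

/-- A strict family: concentrated in stage `0`. -/
def strictW {A B : Bigraded R} (g : GMap A B 0 0) : WMap A B 0 0 :=
  fun m => if h : m = 0 then grecast (0 - (m : ℤ)) (0 - (m : ℤ)) (by omega) (by omega) g else 0

/-- The identity family of maps. -/
def idW (A : Bigraded R) : WMap A A 0 0 := strictW (idG A)

/-! ## The `r`-path of a twisted complex -/

/-- Underlying bigraded module of the `r`-path: `P_r(A)_i^j = A_i^j ⊕ A_{i+r}^{j+r-1} ⊕ A_i^j`. -/
def pathBG (r : ℕ) (A : Bigraded R) : Bigraded R where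
  M i j := A.M i j × (A.M (i + r) (j + r - 1) × A.M i j)
  acg := fun _ _ => inferInstance
  mod := fun _ _ => inferInstance

/-- First projection of the path. -/
def pp1 (r : ℕ) (A : Bigraded R) (i j : ℤ) : (pathBG r A).M i j →ₗ[R] A.M i j :=
  LinearMap.fst R (A.M i j) (A.M (i + r) (j + r - 1) × A.M i j)

/-- Middle projection of the path. -/
def pp2 (r : ℕ) (A : Bigraded R) (i j : ℤ) : (pathBG r A).M i j →ₗ[R] A.M (i + r) (j + r - 1) :=
  (LinearMap.fst R (A.M (i + r) (j + r - 1)) (A.M i j)).comp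
    (LinearMap.snd R (A.M i j) (A.M (i + r) (j + r - 1) × A.M i j))

/-- Last projection of the path. -/
def pp3 (r : ℕ) (A : Bigraded R) (i j : ℤ) : (pathBG r A).M i j →ₗ[R] A.M i j :=
  (LinearMap.snd R (A.M (i + r) (j + r - 1)) (A.M i j)).comp
    (LinearMap.snd R (A.M i j) (A.M (i + r) (j + r - 1) × A.M i j))

/-- The structure maps `D_m` of the `r`-path:
`D_r(x,y,z) = (d_r x, -x - d_r y + z, d_r z)` and
`D_m(x,y,z) = (d_m x, (-1)^{m+r+1} d_m y, d_m z)` for `m ≠ r`. -/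
def pathDRaw (r : ℕ) {A : Bigraded R} (d : WMap A A 0 1) :
    WMap (pathBG r A) (pathBG r A) 0 1 :=
  fun m i j =>
    LinearMap.prod
      ((d m i j).comp (pp1 r A i j))
      (LinearMap.prod
        (if h : m = r then
          - (A.cast (by omega) (by omega)).comp (pp1 r A i j)
          - (A.cast (by ring) (by ring)).comp ((d m (i + r) (j + r - 1)).comp (pp2 r A i j))
          + (A.cast (by omega) (by omega)).comp (pp3 r A i j)
        else
          ((-1 : ℤ) ^ (m + r + 1)) •
            (A.cast (by ring) (by ring)).comp ((d m (i + r) (j + r - 1)).comp (pp2 r A i j)))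
        ((d m i j).comp (pp3 r A i j)))

/-- `∂⁻ : P_r(A) → A`, `(x,y,z) ↦ x`, as a graded map of bidegree `(0,0)`. -/
def projMinusG (r : ℕ) (A : Bigraded R) : GMap (pathBG r A) A 0 0 :=
  fun i j => (A.cast (by ring) (by ring)).comp (pp1 r A i j)

/-- `∂⁺ : P_r(A) → A`, `(x,y,z) ↦ z`, as a graded map of bidegree `(0,0)`. -/
def projPlusG (r : ℕ) (A : Bigraded R) : GMap (pathBG r A) A 0 0 :=
  fun i j => (A.cast (by ring) (by ring)).comp (pp3 r A i j)

/-- `∂⁰ : P_r(A) → A`, `(x,y,z) ↦ y`, of bidegree `(r, r-1)`. -/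
def proj0G (r : ℕ) (A : Bigraded R) : GMap (pathBG r A) A (r : ℤ) ((r : ℤ) - 1) :=
  fun i j => (A.cast (by ring) (by ring)).comp (pp2 r A i j)

/-- `∂⁻` as a strict morphism (family). -/
def projMinusW (r : ℕ) (A : Bigraded R) : WMap (pathBG r A) A 0 0 := strictW (projMinusG r A)

/-- `∂⁺` as a strict morphism (family). -/
def projPlusW (r : ℕ) (A : Bigraded R) : WMap (pathBG r A) A 0 0 := strictW (projPlusG r A)

/-- `ι : A → P_r(A)`, `x ↦ (x,0,x)`, as a graded map of bidegree `(0,0)`. -/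
def iotaG (r : ℕ) (A : Bigraded R) : GMap A (pathBG r A) 0 0 :=
  fun i j => LinearMap.prod (A.cast (by ring) (by ring))
    (LinearMap.prod 0 (A.cast (by ring) (by ring)))

/-- `ι` as a strict morphism (family). -/
def iotaW (r : ℕ) (A : Bigraded R) : WMap A (pathBG r A) 0 0 := strictW (iotaG r A)

/-- An `r`-homotopy from `f` to `g`: a morphism of twisted complexes `h : A → P_r(B)` with
`∂⁻ ∘ h = f` and `∂⁺ ∘ h = g`. -/
def IsRHomotopy (r : ℕ) {A B : Bigraded R} (dA : WMap A A 0 1) (dB : WMap B B 0 1)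
    (f g : WMap A B 0 0) (h : WMap A (pathBG r B) 0 0) : Prop :=
  IsTwMor dA (pathDRaw r dB) h ∧ compFam (projMinusW r B) h = f ∧
    compFam (projPlusW r B) h = g

/-- `f` and `g` are `r`-homotopic. -/
def RHomotopic (r : ℕ) {A B : Bigraded R} (dA : WMap A A 0 1) (dB : WMap B B 0 1)
    (f g : WMap A B 0 0) : Prop :=
  ∃ h, IsRHomotopy r dA dB f g h

/-- The equivalent description of an `r`-homotopy from `f` to `g` as a family of maps
`ĥ_m : A → B` of bidegree `(-m+r, -m+r-1)` satisfying the relations `(H_{m1})`. -/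
def IsHtpFam (r : ℕ) {A B : Bigraded R} (dA : WMap A A 0 1) (dB : WMap B B 0 1)
    (f g : WMap A B 0 0) (hh : WMap A B (r : ℤ) ((r : ℤ) - 1)) : Prop :=
  ∀ m : ℕ,
    (∑ ij ∈ (antidiagonal m).attach,
      (((-1 : ℤ) ^ (ij.1.1 + r)) •
        grecast ((r : ℤ) - m) ((r : ℤ) - m)
          (by have := mem_antidiagonal.mp ij.2; omega)
          (by have := mem_antidiagonal.mp ij.2; omega)
          (gcomp (dB ij.1.1) (hh ij.1.2))
      + ((-1 : ℤ) ^ ij.1.1) •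
        grecast ((r : ℤ) - m) ((r : ℤ) - m)
          (by have := mem_antidiagonal.mp ij.2; omega)
          (by have := mem_antidiagonal.mp ij.2; omega)
          (gcomp (hh ij.1.1) (dA ij.1.2))))
    = if hm : r ≤ m then
        grecast ((r : ℤ) - m) ((r : ℤ) - m) (by omega) (by omega) (g (m - r) - f (m - r))
      else 0

/-- `f` is an `r`-homotopy equivalence. -/
def IsRHomotopyEquiv (r : ℕ) {A B : Bigraded R} (dA : WMap A A 0 1) (dB : WMap B B 0 1)
    (f : WMap A B 0 0) : Prop :=
  ∃ g : WMap B A 0 0, IsTwMor dB dA g ∧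
    RHomotopic r dB dB (compFam f g) (idW B) ∧
    RHomotopic r dA dA (compFam g f) (idW A)

/-- The product of all the components of a bigraded module. -/
abbrev Bigraded.Total (A : Bigraded R) : Type := ∀ i j, A.M i j

section Cast

variable {A : Bigraded R}

@[simp]
theorem Bigraded.cast_rfl {i j : ℤ} (hi : i = i) (hj : j = j) (x : A.M i j) :
    A.cast hi hj x = x := rfl

@[simp]
theorem Bigraded.cast_cast {i i' i'' j j' j'' : ℤ} (hi : i = i') (hj : j = j')
    (hi' : i' = i'') (hj' : j' = j'') (x : A.M i j) :
    A.cast hi' hj' (A.cast hi hj x) = A.cast (hi.trans hi') (hj.trans hj') x := by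
  subst hi hj hi' hj'; rfl

theorem Bigraded.cast_section (a : A.Total) {i i' j j' : ℤ} (hi : i = i') (hj : j = j') :
    A.cast hi hj (a i j) = a i' j' := by
  subst hi hj; rfl

end Cast

/-- The linear map induced by a graded map on the products of all components. -/
def GMap.total {A B : Bigraded R} {p q : ℤ} : GMap A B p q →+ (A.Total →ₗ[R] B.Total) where
  toFun f := LinearMap.pi fun i => LinearMap.pi fun j =>
    (B.cast (sub_add_cancel i p) (sub_add_cancel j q)).comp
      ((f (i - p) (j - q)).comp ((LinearMap.proj (j - q)).comp (LinearMap.proj (i - p))))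
  map_zero' := by ext; simp
  map_add' f g := by ext; simp

section Total

variable {A B C : Bigraded R} {p q p' q' : ℤ}

theorem GMap.total_apply (f : GMap A B p q) (a : A.Total) {i i' j j' : ℤ} (hi : i + p = i')
    (hj : j + q = j') : f.total a i' j' = B.cast hi hj (f i j (a i j)) := by
  obtain rfl : i' - p = i := by omega
  obtain rfl : j' - q = j := by omega
  rfl

theorem GMap.total_injective :
    Function.Injective (GMap.total : GMap A B p q → (A.Total →ₗ[R] B.Total)) := by
  classical
  intro f g h
  funext i j
  ext x
  have := congrFun (congrFun (LinearMap.congr_fun h (Pi.single i (Pi.single j x))) (i + p)) (j + q)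
  rw [GMap.total_apply f _ rfl rfl, GMap.total_apply g _ rfl rfl] at this
  simpa using this

@[simp]
theorem GMap.total_grecast (f : GMap A B p q) (hp : p = p') (hq : q = q') :
    (grecast p' q' hp hq f).total = f.total := by
  subst hp hq; rfl

@[simp]
theorem GMap.total_gcomp (g : GMap B C p' q') (f : GMap A B p q) :
    (gcomp g f).total = g.total.comp f.total := by
  ext a i j
  have hi : i - (p + p') + p + p' = i := by ring
  have hj : j - (q + q') + q + q' = j := by ring
  rw [LinearMap.comp_apply, GMap.total_apply g _ hi hj, GMap.total_apply f a rfl rfl,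
    GMap.total_apply (gcomp g f) a (sub_add_cancel i _) (sub_add_cancel j _)]
  simp [gcomp]

end Total

/-! ### Convolution of sequences of linear maps -/

section Convolution

variable {X Y Z W : Type} [AddCommGroup X] [AddCommGroup Y] [AddCommGroup Z] [AddCommGroup W]
  [Module R X] [Module R Y] [Module R Z] [Module R W]

/-- The convolution product of two sequences of linear maps. -/
def conv (G : ℕ → (Y →ₗ[R] Z)) (F : ℕ → (X →ₗ[R] Y)) : ℕ → (X →ₗ[R] Z) :=
  fun m => ∑ ij ∈ antidiagonal m, (G ij.1).comp (F ij.2)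

theorem conv_assoc (H : ℕ → (Z →ₗ[R] W)) (G : ℕ → (Y →ₗ[R] Z)) (F : ℕ → (X →ₗ[R] Y)) :
    conv (conv H G) F = conv H (conv G F) := by
  funext m
  ext x
  simp only [conv, LinearMap.sum_apply, LinearMap.comp_apply, map_sum, Finset.sum_sigma']
  exact Finset.sum_nbij' (fun ⟨⟨_, k⟩, ⟨i, j⟩⟩ => ⟨(i, j + k), (j, k)⟩)
    (fun ⟨⟨i, _⟩, ⟨j, k⟩⟩ => ⟨(i + j, k), (i, j)⟩)
    (by rintro ⟨⟨_, _⟩, ⟨_, _⟩⟩; simp; omega) (by rintro ⟨⟨_, _⟩, ⟨_, _⟩⟩; simp; omega)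
    (by aesop) (by aesop) (by aesop)

theorem conv_add (G : ℕ → (Y →ₗ[R] Z)) (F F' : ℕ → (X →ₗ[R] Y)) :
    conv G (F + F') = conv G F + conv G F' := by
  funext m; simp [conv, LinearMap.comp_add, Finset.sum_add_distrib]

theorem add_conv (G G' : ℕ → (Y →ₗ[R] Z)) (F : ℕ → (X →ₗ[R] Y)) :
    conv (G + G') F = conv G F + conv G' F := by
  funext m; simp [conv, LinearMap.add_comp, Finset.sum_add_distrib]

theorem conv_zsmul (n : ℤ) (G : ℕ → (Y →ₗ[R] Z)) (F : ℕ → (X →ₗ[R] Y)) :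
    conv G (n • F) = n • conv G F := by
  funext m; ext x; simp [conv, Finset.smul_sum]

theorem zsmul_conv (n : ℤ) (G : ℕ → (Y →ₗ[R] Z)) (F : ℕ → (X →ₗ[R] Y)) :
    conv (n • G) F = n • conv G F := by
  funext m; ext x; simp [conv, Finset.smul_sum]

theorem conv_neg (G : ℕ → (Y →ₗ[R] Z)) (F : ℕ → (X →ₗ[R] Y)) :
    conv G (-F) = -conv G F := by
  simpa using conv_zsmul (-1) G F

theorem neg_conv (G : ℕ → (Y →ₗ[R] Z)) (F : ℕ → (X →ₗ[R] Y)) :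
    conv (-G) F = -conv G F := by
  simpa using zsmul_conv (-1) G F

theorem conv_sub (G : ℕ → (Y →ₗ[R] Z)) (F F' : ℕ → (X →ₗ[R] Y)) :
    conv G (F - F') = conv G F - conv G F' := by
  rw [sub_eq_add_neg, conv_add, conv_neg, ← sub_eq_add_neg]

theorem sub_conv (G G' : ℕ → (Y →ₗ[R] Z)) (F : ℕ → (X →ₗ[R] Y)) :
    conv (G - G') F = conv G F - conv G' F := by
  rw [sub_eq_add_neg, add_conv, neg_conv, ← sub_eq_add_neg]

/-- The sequence `(-1)^m F_m`. -/
def alt (F : ℕ → (X →ₗ[R] Y)) : ℕ → (X →ₗ[R] Y) := fun m => (-1 : ℤ) ^ m • F m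

theorem alt_add (F G : ℕ → (X →ₗ[R] Y)) : alt (F + G) = alt F + alt G := by
  funext m; simp [alt]

theorem alt_neg (F : ℕ → (X →ₗ[R] Y)) : alt (-F) = -alt F := by
  funext m; simp [alt]

@[simp]
theorem alt_alt (F : ℕ → (X →ₗ[R] Y)) : alt (alt F) = F := by
  funext m; simp [alt, smul_smul, ← mul_pow]

theorem alt_conv (G : ℕ → (Y →ₗ[R] Z)) (F : ℕ → (X →ₗ[R] Y)) :
    alt (conv G F) = conv (alt G) (alt F) := by
  funext m
  ext x
  simp only [alt, conv, Finset.smul_sum, LinearMap.sum_apply, LinearMap.smul_apply,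
    LinearMap.comp_apply, map_zsmul]
  refine Finset.sum_congr rfl fun ij hij => ?_
  rw [smul_smul, ← pow_add, add_comm ij.2, mem_antidiagonal.mp hij]

/-- The sequence concentrated in degree `0`. -/
def strictSeq (P : X →ₗ[R] Y) : ℕ → (X →ₗ[R] Y) := fun m => if m = 0 then P else 0

theorem strictSeq_conv (P : Y →ₗ[R] Z) (F : ℕ → (X →ₗ[R] Y)) (m : ℕ) :
    conv (strictSeq P) F m = P.comp (F m) := by
  rw [conv, Finset.sum_eq_single (0, m)]
  · simp [strictSeq]
  · rintro ⟨i, j⟩ hij hne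
    have : i ≠ 0 := by rintro rfl; simp_all
    simp [strictSeq, this]
  · simp

theorem conv_strictSeq (G : ℕ → (Y →ₗ[R] Z)) (P : X →ₗ[R] Y) (m : ℕ) :
    conv G (strictSeq P) m = (G m).comp P := by
  rw [conv, Finset.sum_eq_single (m, 0)]
  · simp [strictSeq]
  · rintro ⟨i, j⟩ hij hne
    have : j ≠ 0 := by rintro rfl; simp_all
    simp [strictSeq, this]
  · simp

@[simp]
theorem alt_strictSeq (P : X →ₗ[R] Y) : alt (strictSeq P) = strictSeq P := by
  funext m; by_cases h : m = 0 <;> simp [alt, strictSeq, h]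

/-- The sequence `0, F_0, F_1, …`. -/
def shift (F : ℕ → (X →ₗ[R] Y)) : ℕ → (X →ₗ[R] Y)
  | 0 => 0
  | m + 1 => F m

theorem shift_conv (G : ℕ → (Y →ₗ[R] Z)) (F : ℕ → (X →ₗ[R] Y)) :
    conv (shift G) F = shift (conv G F) := by
  funext m
  cases m <;> simp [conv, shift, Finset.Nat.antidiagonal_succ]

theorem conv_shift (G : ℕ → (Y →ₗ[R] Z)) (F : ℕ → (X →ₗ[R] Y)) :
    conv G (shift F) = shift (conv G F) := by
  funext m
  cases m <;> simp [conv, shift, Finset.Nat.antidiagonal_succ']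

theorem shift_sub (F G : ℕ → (X →ₗ[R] Y)) : shift (F - G) = shift F - shift G := by
  funext m; cases m <;> simp [shift]

theorem shift_iterate_conv (r : ℕ) (G : ℕ → (Y →ₗ[R] Z)) (F : ℕ → (X →ₗ[R] Y)) :
    conv (shift^[r] G) F = shift^[r] (conv G F) := by
  induction r with
  | zero => rfl
  | succ r ih => simp only [Function.iterate_succ_apply', shift_conv, ih]

theorem conv_shift_iterate (r : ℕ) (G : ℕ → (Y →ₗ[R] Z)) (F : ℕ → (X →ₗ[R] Y)) :
    conv G (shift^[r] F) = shift^[r] (conv G F) := by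
  induction r with
  | zero => rfl
  | succ r ih => simp only [Function.iterate_succ_apply', conv_shift, ih]

theorem shift_iterate_sub (r : ℕ) (F G : ℕ → (X →ₗ[R] Y)) :
    shift^[r] (F - G) = shift^[r] F - shift^[r] G := by
  induction r with
  | zero => rfl
  | succ r ih => simp only [Function.iterate_succ_apply', shift_sub, ih]

theorem shift_iterate_strictSeq (r : ℕ) (P : X →ₗ[R] Y) (m : ℕ) :
    shift^[r] (strictSeq P) m = if m = r then P else 0 := by
  induction r generalizing m with
  | zero => rfl
  | succ r ih =>
    rw [Function.iterate_succ_apply']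
    cases m <;> simp [shift, ih]

end Convolution

/-! ### Families of graded maps as sequences of linear maps -/

/-- The sequence of linear maps induced by a family of graded maps. -/
def WMap.total {A B : Bigraded R} {u v : ℤ} (f : WMap A B u v) : ℕ → (A.Total →ₗ[R] B.Total) :=
  fun m => (f m).total

/-- Convolution of families of graded maps. -/
def convW {A B C : Bigraded R} {u v u' v' : ℤ} (g : WMap B C u' v') (f : WMap A B u v) :
    WMap A C (u + u') (v + v') :=
  fun m => ∑ ij ∈ (antidiagonal m).attach,
    grecast _ _ (by have := mem_antidiagonal.mp ij.2; omega)
      (by have := mem_antidiagonal.mp ij.2; omega) (gcomp (g ij.1.1) (f ij.1.2))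

section WMap

variable {A B C : Bigraded R} {u v u' v' : ℤ}

theorem WMap.total_injective :
    Function.Injective (WMap.total : WMap A B u v → ℕ → (A.Total →ₗ[R] B.Total)) :=
  fun _ _ h => funext fun m => GMap.total_injective (congrFun h m)

theorem WMap.total_convW (g : WMap B C u' v') (f : WMap A B u v) :
    (convW g f).total = conv g.total f.total := by
  funext m
  simp only [WMap.total, convW, map_sum, GMap.total_grecast, GMap.total_gcomp, conv]
  exact Finset.sum_attach (antidiagonal m) fun ij => (g ij.1).total.comp (f ij.2).total

theorem WMap.total_compFam (g : WMap B C 0 0) (f : WMap A B 0 0) :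
    WMap.total (compFam g f) = conv g.total f.total := by
  funext m
  simp only [WMap.total, compFam, map_sum, GMap.total_grecast, GMap.total_gcomp, conv]
  exact Finset.sum_attach (antidiagonal m) fun ij => (g ij.1).total.comp (f ij.2).total

theorem WMap.total_strictW (g : GMap A B 0 0) :
    WMap.total (strictW g) = strictSeq g.total := by
  funext m
  by_cases h : m = 0 <;> simp [WMap.total, strictW, strictSeq, h]

theorem isTwMor_iff (dA : WMap A A 0 1) (dB : WMap B B 0 1) (f : WMap A B 0 0) :
    IsTwMor dA dB f ↔ conv dB.total f.total = conv (alt f.total) dA.total := by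
  rw [IsTwMor, funext_iff]
  refine forall_congr' fun m => ?_
  rw [← GMap.total_injective.eq_iff]
  simp only [map_sum, map_zsmul, GMap.total_grecast, GMap.total_gcomp, conv, alt,
    LinearMap.smul_comp, WMap.total]
  rw [Finset.sum_attach (antidiagonal m) fun ij => (dB ij.1).total.comp (f ij.2).total,
    Finset.sum_attach (antidiagonal m) fun ij =>
      (-1 : ℤ) ^ ij.1 • (f ij.1).total.comp (dA ij.2).total]

theorem IsTwMor.compFam {dA : WMap A A 0 1} {dB : WMap B B 0 1} {dC : WMap C C 0 1}
    {g : WMap B C 0 0} {f : WMap A B 0 0} (hg : IsTwMor dB dC g) (hf : IsTwMor dA dB f) :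
    IsTwMor dA dC (compFam g f) := by
  rw [isTwMor_iff] at *
  rw [WMap.total_compFam, alt_conv, conv_assoc, ← hf, ← conv_assoc, hg, conv_assoc]

end WMap

/-! ### Components of the path -/

section Path

variable {A B : Bigraded R} (r : ℕ)

theorem pp1_cast {i i' j j' : ℤ} (hi : i = i') (hj : j = j') (x : (pathBG r B).M i j) :
    pp1 r B i' j' ((pathBG r B).cast hi hj x) = B.cast hi hj (pp1 r B i j x) := by
  subst hi hj; rfl

theorem pp3_cast {i i' j j' : ℤ} (hi : i = i') (hj : j = j') (x : (pathBG r B).M i j) :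
    pp3 r B i' j' ((pathBG r B).cast hi hj x) = B.cast hi hj (pp3 r B i j x) := by
  subst hi hj; rfl

theorem total_projMinusG_apply (a : (pathBG r B).Total) (i j : ℤ) :
    (projMinusG r B).total a i j = pp1 r B i j (a i j) := by
  rw [GMap.total_apply (projMinusG r B) a (add_zero i) (add_zero j)]
  simp [projMinusG]

theorem total_projPlusG_apply (a : (pathBG r B).Total) (i j : ℤ) :
    (projPlusG r B).total a i j = pp3 r B i j (a i j) := by
  rw [GMap.total_apply (projPlusG r B) a (add_zero i) (add_zero j)]
  simp [projPlusG]

theorem total_proj0G_apply (a : (pathBG r B).Total) {i i' j j' : ℤ} (hi : i + r = i')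
    (hj : j + r - 1 = j') :
    (proj0G r B).total a i' j' = B.cast hi hj (pp2 r B i j (a i j)) := by
  rw [GMap.total_apply (proj0G r B) a hi (show j + ((r : ℤ) - 1) = j' by omega)]
  simp [proj0G]

theorem pathBG_total_ext {a b : (pathBG r B).Total}
    (h₁ : (projMinusG r B).total a = (projMinusG r B).total b)
    (h₂ : (proj0G r B).total a = (proj0G r B).total b)
    (h₃ : (projPlusG r B).total a = (projPlusG r B).total b) : a = b := by
  funext i j
  have h₁ := congrFun (congrFun h₁ i) j
  have h₂ := congrFun (congrFun h₂ (i + r)) (j + r - 1)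
  have h₃ := congrFun (congrFun h₃ i) j
  rw [total_projMinusG_apply, total_projMinusG_apply] at h₁
  rw [total_proj0G_apply r _ rfl rfl, total_proj0G_apply r _ rfl rfl] at h₂
  rw [total_projPlusG_apply, total_projPlusG_apply] at h₃
  exact Prod.ext h₁ (Prod.ext h₂ h₃)

/-- The sequence concentrated in degree `0` at the first projection of the path. -/
abbrev minusSeq (r : ℕ) (B : Bigraded R) : ℕ → ((pathBG r B).Total →ₗ[R] B.Total) := strictSeq (projMinusG r B).total

/-- The sequence concentrated in degree `0` at the middle projection of the path. -/
abbrev midSeq (r : ℕ) (B : Bigraded R) : ℕ → ((pathBG r B).Total →ₗ[R] B.Total) := strictSeq (proj0G r B).total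

/-- The sequence concentrated in degree `0` at the last projection of the path. -/
abbrev plusSeq (r : ℕ) (B : Bigraded R) : ℕ → ((pathBG r B).Total →ₗ[R] B.Total) := strictSeq (projPlusG r B).total

theorem seq_path_ext_iff {X : Type} [AddCommGroup X] [Module R X]
    {F G : ℕ → (X →ₗ[R] (pathBG r B).Total)} :
    F = G ↔ conv (minusSeq r B) F = conv (minusSeq r B) G ∧
      conv (midSeq r B) F = conv (midSeq r B) G ∧ conv (plusSeq r B) F = conv (plusSeq r B) G := by
  refine ⟨by rintro rfl; simp, fun ⟨h₁, h₂, h₃⟩ => ?_⟩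
  funext m
  ext1 x
  have h₁ := congrFun h₁ m
  have h₂ := congrFun h₂ m
  have h₃ := congrFun h₃ m
  rw [strictSeq_conv, strictSeq_conv] at h₁ h₂ h₃
  exact pathBG_total_ext r (LinearMap.congr_fun h₁ x) (LinearMap.congr_fun h₂ x)
    (LinearMap.congr_fun h₃ x)

variable (d : WMap B B 0 1)

theorem minusSeq_conv_pathDRaw :
    conv (minusSeq r B) (pathDRaw r d).total = conv d.total (minusSeq r B) := by
  funext m
  rw [strictSeq_conv, conv_strictSeq]
  ext a i j
  have hi : i - (0 - (m : ℤ)) + (0 - (m : ℤ)) = i := by ring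
  have hj : j - (1 - (m : ℤ)) + (1 - (m : ℤ)) = j := by ring
  simp only [LinearMap.comp_apply, WMap.total, total_projMinusG_apply]
  rw [GMap.total_apply (d m) _ hi hj, GMap.total_apply (pathDRaw r d m) _ hi hj, pp1_cast,
    total_projMinusG_apply]
  rfl

theorem plusSeq_conv_pathDRaw :
    conv (plusSeq r B) (pathDRaw r d).total = conv d.total (plusSeq r B) := by
  funext m
  rw [strictSeq_conv, conv_strictSeq]
  ext a i j
  have hi : i - (0 - (m : ℤ)) + (0 - (m : ℤ)) = i := by ring
  have hj : j - (1 - (m : ℤ)) + (1 - (m : ℤ)) = j := by ring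
  simp only [LinearMap.comp_apply, WMap.total, total_projPlusG_apply]
  rw [GMap.total_apply (d m) _ hi hj, GMap.total_apply (pathDRaw r d m) _ hi hj, pp3_cast,
    total_projPlusG_apply]
  rfl

theorem pp2_pathDRaw_self (i j : ℤ) (x : (pathBG r B).M i j) :
    pp2 r B _ _ (pathDRaw r d r i j x) =
      - B.cast (by ring) (by ring) (pp1 r B i j x)
      - B.cast (by ring) (by ring) (d r (i + r) (j + r - 1) (pp2 r B i j x))
      + B.cast (by ring) (by ring) (pp3 r B i j x) := by
  change (dite (r = r) _ _ : (pathBG r B).M i j →ₗ[R] _) x = _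
  rw [dif_pos rfl]
  rfl

theorem pp2_pathDRaw_of_ne {m : ℕ} (h : m ≠ r) (i j : ℤ) (x : (pathBG r B).M i j) :
    pp2 r B _ _ (pathDRaw r d m i j x) =
      (-1 : ℤ) ^ (m + r + 1) •
        B.cast (by ring) (by ring) (d m (i + r) (j + r - 1) (pp2 r B i j x)) := by
  change (dite (m = r) _ _ : (pathBG r B).M i j →ₗ[R] _) x = _
  rw [dif_neg h]
  rfl

theorem midSeq_conv_pathDRaw :
    conv (midSeq r B) (pathDRaw r d).total =
      -((-1 : ℤ) ^ r • conv (alt d.total) (midSeq r B))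
        + shift^[r] (plusSeq r B - minusSeq r B) := by
  funext m
  rw [shift_iterate_sub]
  simp only [Pi.add_apply, Pi.neg_apply, Pi.smul_apply, Pi.sub_apply, shift_iterate_strictSeq]
  rw [strictSeq_conv, conv_strictSeq]
  ext a i j
  obtain ⟨k, rfl⟩ : ∃ k, i = k + (0 - (m : ℤ)) + r := ⟨i - r - (0 - m), by ring⟩
  obtain ⟨l, rfl⟩ : ∃ l, j = l + (1 - (m : ℤ)) + r - 1 := ⟨j - r + m, by ring⟩
  have hi : k + r + (0 - (m : ℤ)) = k + (0 - (m : ℤ)) + r := by ring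
  have hj : l + r - 1 + (1 - (m : ℤ)) = l + (1 - (m : ℤ)) + r - 1 := by ring
  have key : (d m).total ((proj0G r B).total a) (k + (0 - (m : ℤ)) + r)
      (l + (1 - (m : ℤ)) + r - 1) =
      B.cast hi hj (d m (k + r) (l + r - 1) (pp2 r B k l (a k l))) := by
    rw [GMap.total_apply (d m) _ hi hj, total_proj0G_apply r a rfl rfl]; rfl
  simp only [LinearMap.comp_apply, WMap.total, LinearMap.add_apply, LinearMap.neg_apply, alt,
    LinearMap.smul_apply, Pi.add_apply, Pi.neg_apply, Pi.smul_apply]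
  rw [total_proj0G_apply r _ rfl rfl, GMap.total_apply (pathDRaw r d m) a rfl rfl, key]
  by_cases h : m = r
  · subst h
    have e₁ := B.cast_section ((projMinusG m B).total a) (i := k) (j := l)
      (i' := k + (0 - (m : ℤ)) + m) (j' := l + (1 - (m : ℤ)) + m - 1) (by ring) (by ring)
    have e₃ := B.cast_section ((projPlusG m B).total a) (i := k) (j := l)
      (i' := k + (0 - (m : ℤ)) + m) (j' := l + (1 - (m : ℤ)) + m - 1) (by ring) (by ring)
    rw [total_projMinusG_apply] at e₁
    rw [total_projPlusG_apply] at e₃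
    rw [Bigraded.cast_rfl, Bigraded.cast_rfl, pp2_pathDRaw_self]
    simp [smul_smul, ← mul_pow, ← e₁, ← e₃]
    abel
  · rw [Bigraded.cast_rfl, Bigraded.cast_rfl, pp2_pathDRaw_of_ne r d h]
    simp [h, smul_smul, pow_add, mul_comm]

/-- The family of maps into the path with prescribed components. -/
def pathLift (f : WMap A B 0 0) (h : WMap A B (r : ℤ) ((r : ℤ) - 1)) (g : WMap A B 0 0) :
    WMap A (pathBG r B) 0 0 :=
  fun m i j => LinearMap.prod (f m i j)
    (LinearMap.prod ((B.cast (by ring) (by ring)).comp (h m i j)) (g m i j))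

variable (f g : WMap A B 0 0) (h : WMap A B (r : ℤ) ((r : ℤ) - 1))

theorem minusSeq_conv_pathLift :
    conv (minusSeq r B) (pathLift r f h g).total = f.total := by
  funext m
  rw [strictSeq_conv]
  ext a i j
  have hi : i - (0 - (m : ℤ)) + (0 - (m : ℤ)) = i := by ring
  have hj : j - (0 - (m : ℤ)) + (0 - (m : ℤ)) = j := by ring
  simp only [LinearMap.comp_apply, WMap.total, total_projMinusG_apply]
  rw [GMap.total_apply (f m) _ hi hj, GMap.total_apply (pathLift r f h g m) _ hi hj, pp1_cast]
  rfl

theorem plusSeq_conv_pathLift :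
    conv (plusSeq r B) (pathLift r f h g).total = g.total := by
  funext m
  rw [strictSeq_conv]
  ext a i j
  have hi : i - (0 - (m : ℤ)) + (0 - (m : ℤ)) = i := by ring
  have hj : j - (0 - (m : ℤ)) + (0 - (m : ℤ)) = j := by ring
  simp only [LinearMap.comp_apply, WMap.total, total_projPlusG_apply]
  rw [GMap.total_apply (g m) _ hi hj, GMap.total_apply (pathLift r f h g m) _ hi hj, pp3_cast]
  rfl

theorem midSeq_conv_pathLift :
    conv (midSeq r B) (pathLift r f h g).total = h.total := by
  funext m
  rw [strictSeq_conv]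
  ext a i j
  have hi : i - ((r : ℤ) - m) + ((r : ℤ) - m) = i := by ring
  have hj : j - ((r : ℤ) - 1 - m) + ((r : ℤ) - 1 - m) = j := by ring
  have hi' : i - ((r : ℤ) - m) + (0 - (m : ℤ)) + r = i := by ring
  have hj' : j - ((r : ℤ) - 1 - m) + (0 - (m : ℤ)) + r - 1 = j := by ring
  simp only [LinearMap.comp_apply, WMap.total]
  rw [GMap.total_apply (h m) _ hi hj, total_proj0G_apply r _ hi' hj',
    GMap.total_apply (pathLift r f h g m) _ rfl rfl]
  exact B.cast_cast _ _ _ _ _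

end Path

section Homotopy

variable {A B C : Bigraded R} {r : ℕ}

/-- The homotopy relation for a family of maps `A → B`, written with convolutions. -/
def IsConvHtp (r : ℕ) (dA : WMap A A 0 1) (dB : WMap B B 0 1) (f g : WMap A B 0 0)
    (h : WMap A B (r : ℤ) ((r : ℤ) - 1)) : Prop :=
  (-1 : ℤ) ^ r • conv (alt dB.total) h.total + conv (alt h.total) dA.total =
    shift^[r] (g.total - f.total)

variable {dA : WMap A A 0 1} {dB : WMap B B 0 1} {dC : WMap C C 0 1}

theorem isTwMor_path_iff {H : WMap A (pathBG r B) 0 0} :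
    IsTwMor dA (pathDRaw r dB) H ↔
      conv dB.total (conv (minusSeq r B) H.total) =
        conv (alt (conv (minusSeq r B) H.total)) dA.total ∧
      (-1 : ℤ) ^ r • conv (alt dB.total) (conv (midSeq r B) H.total) +
        conv (alt (conv (midSeq r B) H.total)) dA.total =
        shift^[r] (conv (plusSeq r B) H.total - conv (minusSeq r B) H.total) ∧
      conv dB.total (conv (plusSeq r B) H.total) =
        conv (alt (conv (plusSeq r B) H.total)) dA.total := by
  rw [isTwMor_iff, seq_path_ext_iff]
  simp only [alt_conv, alt_strictSeq, ← conv_assoc, minusSeq_conv_pathDRaw,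
    plusSeq_conv_pathDRaw, midSeq_conv_pathDRaw, add_conv, neg_conv, zsmul_conv,
    shift_iterate_conv, sub_conv]
  refine and_congr Iff.rfl (and_congr ?_ Iff.rfl)
  constructor <;> intro h
  · rw [← h]; abel
  · rw [← h]; abel

theorem isRHomotopy_iff {f g : WMap A B 0 0} {H : WMap A (pathBG r B) 0 0} :
    IsRHomotopy r dA dB f g H ↔ IsTwMor dA (pathDRaw r dB) H ∧
      conv (minusSeq r B) H.total = f.total ∧ conv (plusSeq r B) H.total = g.total := by
  rw [IsRHomotopy, ← WMap.total_injective.eq_iff, ← WMap.total_injective.eq_iff (b := g),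
    WMap.total_compFam, WMap.total_compFam, projMinusW, projPlusW, WMap.total_strictW,
    WMap.total_strictW]

/-- The middle component of a family of maps into the path. -/
def midW (H : WMap A (pathBG r B) 0 0) : WMap A B (r : ℤ) ((r : ℤ) - 1) :=
  fun m => grecast _ _ (by ring) (by ring) (gcomp (proj0G r B) (H m))

theorem total_midW (H : WMap A (pathBG r B) 0 0) :
    (midW H).total = conv (midSeq r B) H.total := by
  funext m
  rw [strictSeq_conv]
  simp [WMap.total, midW]

theorem rHomotopic_iff_exists_isConvHtp {f g : WMap A B 0 0} (hf : IsTwMor dA dB f)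
    (hg : IsTwMor dA dB g) :
    RHomotopic r dA dB f g ↔ ∃ h, IsConvHtp r dA dB f g h := by
  constructor
  · rintro ⟨H, hH⟩
    obtain ⟨hH, h₁, h₃⟩ := isRHomotopy_iff.mp hH
    refine ⟨midW H, ?_⟩
    have := (isTwMor_path_iff.mp hH).2.1
    rwa [h₁, h₃, ← total_midW] at this
  · rintro ⟨h, hh⟩
    rw [isTwMor_iff] at hf hg
    refine ⟨pathLift r f h g, isRHomotopy_iff.mpr ⟨isTwMor_path_iff.mpr ?_,
      minusSeq_conv_pathLift r f g h, plusSeq_conv_pathLift r f g h⟩⟩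
    rw [minusSeq_conv_pathLift, plusSeq_conv_pathLift, midSeq_conv_pathLift]
    exact ⟨hf, hh, hg⟩

theorem WMap.total_add {u v : ℤ} (f g : WMap A B u v) :
    WMap.total (f + g) = f.total + g.total :=
  funext fun m => map_add GMap.total (f m) (g m)

theorem WMap.total_neg {u v : ℤ} (f : WMap A B u v) : WMap.total (-f) = -f.total :=
  funext fun m => map_neg GMap.total (f m)

theorem IsConvHtp.refl (f : WMap A B 0 0) : IsConvHtp r dA dB f f 0 := by
  have h0 : WMap.total (0 : WMap A B (r : ℤ) ((r : ℤ) - 1)) = 0 :=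
    funext fun m => map_zero GMap.total
  have hs := shift_iterate_sub r f.total f.total
  rw [sub_self (shift^[r] f.total)] at hs
  rw [IsConvHtp, h0, hs]
  funext m
  simp [conv, alt]

theorem IsConvHtp.symm {f g : WMap A B 0 0} {h : WMap A B (r : ℤ) ((r : ℤ) - 1)}
    (hh : IsConvHtp r dA dB f g h) : IsConvHtp r dA dB g f (-h) := by
  rw [IsConvHtp, shift_iterate_sub] at *
  rw [WMap.total_neg, alt_neg, conv_neg, neg_conv, ← neg_sub (shift^[r] g.total), ← hh, smul_neg]
  abel

theorem IsConvHtp.trans {f g k : WMap A B 0 0} {h h' : WMap A B (r : ℤ) ((r : ℤ) - 1)}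
    (hh : IsConvHtp r dA dB f g h) (hh' : IsConvHtp r dA dB g k h') :
    IsConvHtp r dA dB f k (h + h') := by
  rw [IsConvHtp, shift_iterate_sub] at *
  rw [WMap.total_add, alt_add, conv_add, add_conv, smul_add,
    ← sub_add_sub_cancel' (shift^[r] g.total), ← hh, ← hh']
  abel

theorem IsConvHtp.exists_precomp {f' g' : WMap B C 0 0}
    {h' : WMap B C (r : ℤ) ((r : ℤ) - 1)} (hh' : IsConvHtp r dB dC f' g' h')
    {g : WMap A B 0 0} (hg : IsTwMor dA dB g) :
    ∃ h, IsConvHtp r dA dC (compFam f' g) (compFam g' g) h := by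
  rw [isTwMor_iff] at hg
  obtain ⟨h, hh⟩ : ∃ h : WMap A C (r : ℤ) ((r : ℤ) - 1), h.total = conv h'.total g.total := by
    have := WMap.total_convW h' g
    rw [← this]
    generalize convW h' g = k
    revert k
    rw [zero_add, zero_add]
    exact fun k => ⟨k, rfl⟩
  refine ⟨h, ?_⟩
  rw [IsConvHtp] at *
  rw [hh, alt_conv, conv_assoc, ← hg, ← conv_assoc, ← conv_assoc, ← zsmul_conv, ← add_conv, hh',
    shift_iterate_conv, sub_conv, WMap.total_compFam, WMap.total_compFam]

theorem IsConvHtp.exists_postcomp {f g : WMap A B 0 0}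
    {h : WMap A B (r : ℤ) ((r : ℤ) - 1)} (hh : IsConvHtp r dA dB f g h)
    {f' : WMap B C 0 0} (hf' : IsTwMor dB dC f') :
    ∃ h, IsConvHtp r dA dC (compFam f' f) (compFam f' g) h := by
  rw [isTwMor_iff] at hf'
  have hf'' : conv (alt dC.total) (alt f'.total) = conv f'.total (alt dB.total) := by
    rw [← alt_conv, hf', alt_conv, alt_alt]
  obtain ⟨k, hk⟩ : ∃ k : WMap A C (r : ℤ) ((r : ℤ) - 1),
      k.total = conv (alt f'.total) h.total := by
    have hs : WMap.total (fun m => (-1 : ℤ) ^ m • f' m : WMap B C 0 0) = alt f'.total :=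
      funext fun m => map_zsmul GMap.total _ (f' m)
    rw [← hs, ← WMap.total_convW]
    generalize convW _ h = k
    revert k
    rw [add_zero, add_zero]
    exact fun k => ⟨k, rfl⟩
  refine ⟨k, ?_⟩
  rw [IsConvHtp] at *
  rw [hk, alt_conv, alt_alt, ← conv_assoc, hf'', conv_assoc, conv_assoc, ← conv_zsmul,
    ← conv_add, hh, conv_shift_iterate, conv_sub, WMap.total_compFam, WMap.total_compFam]

end Homotopy

/-- For every `r ≥ 0` and all twisted complexes `A, B`, the relation
"there exists an `r`-homotopy from `f` to `g`" is an equivalence relation on morphisms of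
twisted complexes `A → B`, compatible with composition. -/
theorem rHomotopic_equivalence_and_comp {R : Type} [CommRing R] (r : ℕ) :
    (∀ (A B : TwComplex R) (f : TwMorphism A B), RHomotopic r A.d B.d f.f f.f) ∧
    (∀ (A B : TwComplex R) (f g : TwMorphism A B),
        RHomotopic r A.d B.d f.f g.f → RHomotopic r A.d B.d g.f f.f) ∧
    (∀ (A B : TwComplex R) (f g h : TwMorphism A B),
        RHomotopic r A.d B.d f.f g.f → RHomotopic r A.d B.d g.f h.f →
        RHomotopic r A.d B.d f.f h.f) ∧
    (∀ (A B C : TwComplex R) (f g : TwMorphism A B) (f' g' : TwMorphism B C),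
        RHomotopic r A.d B.d f.f g.f → RHomotopic r B.d C.d f'.f g'.f →
        RHomotopic r A.d C.d (compFam f'.f f.f) (compFam g'.f g.f)) := by
  refine ⟨fun A B f => ?_, fun A B f g h => ?_, fun A B f g k h h' => ?_,
    fun A B C f g f' g' h h' => ?_⟩
  · rw [rHomotopic_iff_exists_isConvHtp f.isMor f.isMor]
    exact ⟨0, .refl _⟩
  · rw [rHomotopic_iff_exists_isConvHtp g.isMor f.isMor]
    obtain ⟨_, hh⟩ := (rHomotopic_iff_exists_isConvHtp f.isMor g.isMor).mp h
    exact ⟨_, hh.symm⟩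
  · rw [rHomotopic_iff_exists_isConvHtp f.isMor k.isMor]
    obtain ⟨_, hh⟩ := (rHomotopic_iff_exists_isConvHtp f.isMor g.isMor).mp h
    obtain ⟨_, hh'⟩ := (rHomotopic_iff_exists_isConvHtp g.isMor k.isMor).mp h'
    exact ⟨_, hh.trans hh'⟩
  · rw [rHomotopic_iff_exists_isConvHtp (f'.isMor.compFam f.isMor) (g'.isMor.compFam g.isMor)]
    obtain ⟨_, hh⟩ := (rHomotopic_iff_exists_isConvHtp f.isMor g.isMor).mp h
    obtain ⟨_, hh'⟩ := (rHomotopic_iff_exists_isConvHtp f'.isMor g'.isMor).mp h'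
    obtain ⟨_, hk⟩ := hh.exists_postcomp f'.isMor
    obtain ⟨_, hk'⟩ := hh'.exists_precomp g.isMor
    exact ⟨_, hk.trans hk'⟩
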